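/- Let X be a median graph of dimension at most D and staircase length at most σ (D, σ natural numbers), let a group Γ act on X by graph automorphisms, and let s = (h_1 ⊋ ⋯ ⊋ h_l) and r = (k_1 ⊋ ⋯ ⊋ k_p) be H-segments in X (l, p ≥ 1). Assume that for each a ∈ {h_1, h_l}, each b ∈ {k_1, k_p}, and all γ, γ' ∈ Γ, the halfspaces γ·a and γ'·b are not transverse. Then the 2-cochain δ¹f_r is non-transverse to the orbit Γs, and consequently there exists a bounded Γ-invariant function β : V⁴ → ℝ with δβ = (δ¹f_s) ∪ (δ¹f_r) as functions V⁵ → ℝ; that is, [δ¹f_s] ∪ [δ¹f_r] = 0 in degree-4 Γ-equivariant bounded cohomology of X. -/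

import Mathlib

open scoped BigOperators

namespace MedianQM

variable {V : Type*}

/-- The interval `[x,y]`: vertices on geodesics from `x` to `y`. -/
def interval (X : SimpleGraph V) (x y : V) : Set V :=
  {m | X.dist x m + X.dist m y = X.dist x y}

/-- A median graph: connected, and any three vertices admit a unique median. -/
def IsMedianGraph (X : SimpleGraph V) : Prop :=
  X.Connected ∧ ∀ x y z : V, ∃! m : V,
    m ∈ interval X x y ∧ m ∈ interval X y z ∧ m ∈ interval X x z

/-- A halfspace of `X`: the set of vertices strictly closer to one endpoint of
an edge than to the other. -/
def IsHalfspace (X : SimpleGraph V) (h : Set V) : Prop :=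
  ∃ a b : V, X.Adj a b ∧ h = {v | X.dist v a < X.dist v b}

/-- The edge `{a,b}` is dual to the halfspace `h` (equivalently, to the
hyperplane `{h, h̄}`). -/
def EdgeDual (X : SimpleGraph V) (h : Set V) (a b : V) : Prop :=
  X.Adj a b ∧
    (h = {v | X.dist v a < X.dist v b} ∨ h = {v | X.dist v b < X.dist v a})

/-- Two halfspaces are transverse. -/
def Transv (h k : Set V) : Prop :=
  (h ∩ k).Nonempty ∧ (hᶜ ∩ k).Nonempty ∧ (h ∩ kᶜ).Nonempty ∧ (hᶜ ∩ kᶜ).Nonempty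

/-- `[x,y]_H`: the set of halfspaces separating `y` from `x`. -/
def sepH (X : SimpleGraph V) (x y : V) : Set (Set V) :=
  {h | IsHalfspace X h ∧ y ∈ h ∧ x ∉ h}

/-- `X` has dimension at most `D`: every (finite) family of pairwise transverse
halfspaces has at most `D` elements. -/
def DimLE (X : SimpleGraph V) (D : ℕ) : Prop :=
  ∀ S : Finset (Set V), (∀ h ∈ S, IsHalfspace X h) →
    (∀ h ∈ S, ∀ k ∈ S, h ≠ k → Transv h k) → S.card ≤ D

/-- `h ⊋ k` are tightly nested: no halfspace lies strictly between them. -/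
def TightlyNested (X : SimpleGraph V) (h k : Set V) : Prop :=
  k ⊂ h ∧ ¬ ∃ h' : Set V, IsHalfspace X h' ∧ h' ⊂ h ∧ k ⊂ h'

/-- A staircase of length `n`. -/
def IsStaircase (X : SimpleGraph V) (n : ℕ) (h k : Fin n → Set V) : Prop :=
  (∀ i, IsHalfspace X (h i)) ∧ (∀ i, IsHalfspace X (k i)) ∧
  (∀ i j : Fin n, i < j → h j ⊂ h i) ∧ (∀ i j : Fin n, i < j → k j ⊂ k i) ∧
  (∀ i, k i ⊂ h i) ∧ (∀ i j : Fin n, j < i → Transv (h i) (k j))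

/-- `X` has staircase length at most `σ`: there is no staircase of length `σ+1`. -/
def StaircaseLE (X : SimpleGraph V) (σ : ℕ) : Prop :=
  ∀ h k : Fin (σ + 1) → Set V, ¬ IsStaircase X (σ + 1) h k

/-- An `H`-segment of length `l`: a tuple of consecutively tightly nested
halfspaces `h₁ ⊋ ⋯ ⊋ h_l`. -/
def IsHSegment (X : SimpleGraph V) (l : ℕ) (s : Fin l → Set V) : Prop :=
  (∀ i, IsHalfspace X (s i)) ∧
  ∀ i j : Fin l, (j : ℕ) = (i : ℕ) + 1 → TightlyNested X (s i) (s j)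

/-- The segment `t` is contained in `[x,y]_H`. -/
def SegIn (X : SimpleGraph V) (x y : V) {l : ℕ} (t : Fin l → Set V) : Prop :=
  ∀ i, t i ∈ sepH X x y

/-- The translate of a segment by a group element. -/
def segSMul {Γ : Type*} [SMul Γ V] (γ : Γ) {l : ℕ} (s : Fin l → Set V) :
    Fin l → Set V :=
  fun i => (γ • ·) '' s i

/-- The set of translates of `s` contained in `[x,y]_H`. -/
def translatesIn (X : SimpleGraph V) (Γ : Type*) [SMul Γ V] {l : ℕ}
    (s : Fin l → Set V) (x y : V) : Set (Fin l → Set V) :=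
  {t | (∃ γ : Γ, t = segSMul γ s) ∧ SegIn X x y t}

/-- The median quasimorphism of the segment `s` (for the action of `Γ` on `X`). -/
noncomputable def fs (X : SimpleGraph V) (Γ : Type*) [SMul Γ V] {l : ℕ}
    (s : Fin l → Set V) (x y : V) : ℝ :=
  ((translatesIn X Γ s x y).ncard : ℝ) - ((translatesIn X Γ s y x).ncard : ℝ)

/-- The coboundary of a function of two variables, evaluated on a triple. -/
noncomputable def d1 (f : V → V → ℝ) (x y z : V) : ℝ := f y z - f x z + f x y

/-- The simplicial coboundary operator. -/
noncomputable def cob {W : Type*} {m : ℕ} (β : (Fin (m + 1) → W) → ℝ) :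
    (Fin (m + 2) → W) → ℝ :=
  fun x => ∑ j : Fin (m + 2), (-1 : ℝ) ^ (j : ℕ) * β (fun i => x (j.succAbove i))

/-- Γ-invariance of a cochain. -/
def IsInvariant (Γ : Type*) {W : Type*} [SMul Γ W] {m : ℕ}
    (β : (Fin m → W) → ℝ) : Prop :=
  ∀ (γ : Γ) (x : Fin m → W), β (fun i => γ • x i) = β x

/-- Boundedness of a real-valued function. -/
def IsBounded {α : Type*} (β : α → ℝ) : Prop := ∃ C : ℝ, ∀ x, |β x| ≤ C

/-- A head of the segment `s`. -/
def IsHead (X : SimpleGraph V) {l : ℕ} (hl : 0 < l) (s : Fin l → Set V)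
    (a : V) : Prop :=
  a ∉ s ⟨0, hl⟩ ∧ ∃ b, EdgeDual X (s ⟨0, hl⟩) a b

/-- A tail of the segment `s`. -/
def IsTail (X : SimpleGraph V) {l : ℕ} (hl : 0 < l) (s : Fin l → Set V)
    (a : V) : Prop :=
  a ∈ s ⟨l - 1, by omega⟩ ∧ ∃ b, EdgeDual X (s ⟨l - 1, by omega⟩) a b

/-- The cochain `κ` is non-transverse to the segment `s`. -/
def NonTransverseTo (X : SimpleGraph V) {n l : ℕ} (hl : 0 < l)
    (κ : (Fin (n + 1) → V) → ℝ) (s : Fin l → Set V) : Prop :=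
  (∀ (x : Fin n → V) (a a' : V), IsHead X hl s a → IsHead X hl s a' →
    κ (Fin.cons a x) = κ (Fin.cons a' x)) ∧
  (∀ (x : Fin n → V) (a a' : V), IsTail X hl s a → IsTail X hl s a' →
    κ (Fin.cons a x) = κ (Fin.cons a' x))

/-- The action of `Γ` on `X` is by graph automorphisms. -/
def ActsOn (Γ : Type*) [SMul Γ V] (X : SimpleGraph V) : Prop :=
  ∀ (γ : Γ) (a b : V), X.Adj a b → X.Adj (γ • a) (γ • b)


section Halfspaces

variable {X : SimpleGraph V}

theorem dist_ne_of_adj (hmed : IsMedianGraph X) {a b : V} (hab : X.Adj a b) (v : V) :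
    X.dist v a ≠ X.dist v b := by
  intro h
  have h1 : X.dist a b = 1 := SimpleGraph.dist_eq_one_iff_adj.2 hab
  obtain ⟨m, ⟨hm1, hm2, hm3⟩, -⟩ := hmed.2 v a b
  simp only [interval, Set.mem_ofPred_eq] at hm1 hm2 hm3
  have hm : X.dist a m = 0 ∨ X.dist m b = 0 := by omega
  rcases hm with hm | hm
  · rw [hmed.1.dist_eq_zero_iff] at hm
    subst hm
    omega
  · rw [hmed.1.dist_eq_zero_iff] at hm
    subst hm
    rw [SimpleGraph.dist_comm (u := m) (v := a)] at hm1
    omega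

theorem compl_setOf_dist_lt (hmed : IsMedianGraph X) {a b : V} (hab : X.Adj a b) :
    {v | X.dist v a < X.dist v b}ᶜ = {v | X.dist v b < X.dist v a} := by
  ext v
  have := dist_ne_of_adj hmed hab v
  simp only [Set.mem_compl_iff, Set.mem_ofPred_eq]
  omega

theorem IsHalfspace.compl (hmed : IsMedianGraph X) {h : Set V} (hh : IsHalfspace X h) :
    IsHalfspace X hᶜ := by
  obtain ⟨a, b, hab, rfl⟩ := hh
  exact ⟨b, a, hab.symm, compl_setOf_dist_lt hmed hab⟩

theorem dist_lt_of_mem_interval_of_adj (hmed : IsMedianGraph X) {a b u w v : V}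
    (hab : X.Adj a b) (huw : X.Adj u w) (hu : X.dist u a < X.dist u b)
    (hv : X.dist v a < X.dist v b) (hw : w ∈ interval X u v) :
    X.dist w a < X.dist w b := by
  by_contra hwab
  have hc := hmed.1
  have hwne := dist_ne_of_adj hmed hab w
  have h1 : X.dist a b = 1 := SimpleGraph.dist_eq_one_iff_adj.2 hab
  have h1' : X.dist b a = 1 := SimpleGraph.dist_eq_one_iff_adj.2 hab.symm
  have h2 : X.dist u w = 1 := SimpleGraph.dist_eq_one_iff_adj.2 huw
  have h2' : X.dist w u = 1 := SimpleGraph.dist_eq_one_iff_adj.2 huw.symm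
  have t1 := hc.dist_triangle (u := u) (v := a) (w := b)
  have t2 := hc.dist_triangle (u := w) (v := b) (w := a)
  have t3 := hc.dist_triangle (u := u) (v := w) (w := b)
  have t4 := hc.dist_triangle (u := w) (v := u) (w := a)
  have t5 := hc.dist_triangle (u := v) (v := a) (w := b)
  -- the median of `u, v, a` and the median of `w, v, b` are both the median of `u, v, b`
  obtain ⟨m, ⟨hm1, hm2, hm3⟩, -⟩ := hmed.2 u v a
  obtain ⟨z, ⟨hz1, hz2, hz3⟩, -⟩ := hmed.2 w v b
  obtain ⟨q, -, hq⟩ := hmed.2 u v b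
  simp only [interval, Set.mem_ofPred_eq] at *
  have s1 := hc.dist_triangle (u := m) (v := a) (w := b)
  have s2 := hc.dist_triangle (u := u) (v := m) (w := b)
  have s3 := hc.dist_triangle (u := v) (v := m) (w := b)
  have r1 := hc.dist_triangle (u := u) (v := w) (w := z)
  have r2 := hc.dist_triangle (u := u) (v := z) (w := b)
  have r3 := hc.dist_triangle (u := u) (v := z) (w := v)
  have r4 := hc.dist_triangle (u := w) (v := z) (w := a)
  have hmq := hq m ⟨by omega, by omega, by omega⟩
  have hzq := hq z ⟨by omega, by omega, by omega⟩
  subst hmq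
  subst hzq
  omega

theorem IsHalfspace.mem_of_mem_interval (hmed : IsMedianGraph X) {h : Set V}
    (hh : IsHalfspace X h) {u v w : V} (hu : u ∈ h) (hv : v ∈ h) (hw : w ∈ interval X u v) :
    w ∈ h := by
  obtain ⟨a, b, hab, rfl⟩ := hh
  have hc := hmed.1
  obtain ⟨n, hn⟩ : ∃ n, X.dist u w = n := ⟨_, rfl⟩
  induction n generalizing u with
  | zero =>
    rw [hc.dist_eq_zero_iff] at hn
    exact hn ▸ hu
  | succ n ih =>
    obtain ⟨p, hp⟩ := hc.exists_walk_length_eq_dist u w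
    cases p with
    | nil => simp_all
    | @cons _ u' _ huu' p' =>
      have h1 : X.dist u u' = 1 := SimpleGraph.dist_eq_one_iff_adj.2 huu'
      have h2 := SimpleGraph.dist_le p'
      simp only [SimpleGraph.Walk.length_cons] at hp
      have t1 := hc.dist_triangle (u := u) (v := u') (w := w)
      have t2 := hc.dist_triangle (u := u) (v := u') (w := v)
      have t3 := hc.dist_triangle (u := u') (v := w) (w := v)
      simp only [interval, Set.mem_ofPred_eq] at hw
      refine ih (u := u') ?_ ?_ (by omega)
      · simp only [interval, Set.mem_ofPred_eq]
        omega
      · refine dist_lt_of_mem_interval_of_adj hmed hab huu' hu hv ?_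
        simp only [interval, Set.mem_ofPred_eq]
        omega

/-- A halfspace is determined by any edge crossing its boundary. -/
theorem IsHalfspace.eq_setOf_dist_lt (hmed : IsMedianGraph X) {h : Set V}
    (hh : IsHalfspace X h) {c d : V} (hcd : X.Adj c d) (hc : c ∈ h) (hd : d ∉ h) :
    h = {v | X.dist v c < X.dist v d} := by
  have h1 : X.dist c d = 1 := SimpleGraph.dist_eq_one_iff_adj.2 hcd
  have h1' : X.dist d c = 1 := SimpleGraph.dist_eq_one_iff_adj.2 hcd.symm
  ext v
  have hne := dist_ne_of_adj hmed hcd v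
  have t1 := hmed.1.dist_triangle (u := v) (v := d) (w := c)
  have t2 := hmed.1.dist_triangle (u := v) (v := c) (w := d)
  simp only [Set.mem_ofPred_eq]
  constructor
  · intro hv
    by_contra hlt
    refine hd (hh.mem_of_mem_interval hmed hv hc ?_)
    simp only [interval, Set.mem_ofPred_eq]
    omega
  · intro hlt
    by_contra hv
    refine (hh.compl hmed).mem_of_mem_interval hmed (w := c) hv hd ?_ hc
    simp only [interval, Set.mem_ofPred_eq]
    omega

theorem sepH_finite (hmed : IsMedianGraph X) (x y : V) : (sepH X x y).Finite := by
  obtain ⟨p⟩ := hmed.1.preconnected x y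
  induction p with
  | nil =>
    refine Set.Finite.subset Set.finite_empty ?_
    rintro h ⟨-, h1, h2⟩
    exact h2 h1
  | @cons u v w huv p ih =>
    refine (ih.union (Set.finite_singleton {z | X.dist z v < X.dist z u})).subset ?_
    rintro h ⟨hh, hw, hu⟩
    by_cases hv : v ∈ h
    · exact Or.inr (hh.eq_setOf_dist_lt hmed huv.symm hv hu)
    · exact Or.inl ⟨hh, hw, hv⟩

theorem EdgeDual.mem_iff_notMem {h : Set V} {a b : V} (hab : EdgeDual X h a b) :
    a ∈ h ↔ b ∉ h := by
  obtain ⟨hadj, rfl | rfl⟩ := hab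
  all_goals
    have h1 : X.dist a b = 1 := SimpleGraph.dist_eq_one_iff_adj.2 hadj
    have h1' : X.dist b a = 1 := SimpleGraph.dist_eq_one_iff_adj.2 hadj.symm
    simp [h1, h1']

theorem EdgeDual.isHalfspace {h : Set V} {a b : V} (hab : EdgeDual X h a b) :
    IsHalfspace X h := by
  obtain ⟨hadj, rfl | rfl⟩ := hab
  exacts [⟨a, b, hadj, rfl⟩, ⟨b, a, hadj.symm, rfl⟩]

theorem EdgeDual.mem_iff_mem_of_mem_iff_mem (hmed : IsMedianGraph X) {h k : Set V} {a b a' : V}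
    (hab : EdgeDual X h a b) (hk : IsHalfspace X k)
    (haa' : a ∈ h ↔ a' ∈ h) (hne : ¬ (a ∈ k ↔ a' ∈ k)) : a ∈ k ↔ b ∈ k := by
  by_contra hb
  have hh := hab.isHalfspace
  have hiff := hab.mem_iff_notMem
  -- `h` is `k` or its complement, as both are bounded by the edge `a b`
  have key : h = k ∨ h = kᶜ := by
    by_cases ha : a ∈ k
    · have hbk : b ∉ k := fun hbk => hb (iff_of_true ha hbk)
      have e1 := hk.eq_setOf_dist_lt hmed hab.1 ha hbk
      have e2 := compl_setOf_dist_lt hmed hab.1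
      rw [← e1] at e2
      rcases hab.2 with e | e
      · exact Or.inl (e.trans e1.symm)
      · exact Or.inr (e.trans e2.symm)
    · have hbk : b ∈ k := by tauto
      have e1 := hk.eq_setOf_dist_lt hmed hab.1.symm hbk ha
      have e2 := compl_setOf_dist_lt hmed hab.1.symm
      rw [← e1] at e2
      rcases hab.2 with e | e
      · exact Or.inr (e.trans e2.symm)
      · exact Or.inl (e.trans e1.symm)
  rcases key with rfl | rfl
  · exact hne haa'
  · simp only [Set.mem_compl_iff] at haa'
    tauto

/-- A halfspace separating two vertices on the same side of the carrier of `h` is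
transverse to `h`. -/
theorem mem_iff_mem_of_not_transv (hmed : IsMedianGraph X) {h k : Set V} {a b a' b' : V}
    (hab : EdgeDual X h a b) (hab' : EdgeDual X h a' b') (haa' : a ∈ h ↔ a' ∈ h)
    (hk : IsHalfspace X k) (hnt : ¬ Transv h k) : a ∈ k ↔ a' ∈ k := by
  by_contra hne
  have h1 := hab.mem_iff_mem_of_mem_iff_mem hmed hk haa' hne
  have h2 := hab'.mem_iff_mem_of_mem_iff_mem hmed hk haa'.symm (fun h => hne h.symm)
  have h3 := hab.mem_iff_notMem
  have h4 := hab'.mem_iff_notMem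
  apply hnt
  have aux : ∀ (P : V → Prop), (P a ∨ P b ∨ P a' ∨ P b') → ∃ v, P v := by
    rintro P (h | h | h | h)
    exacts [⟨_, h⟩, ⟨_, h⟩, ⟨_, h⟩, ⟨_, h⟩]
  refine ⟨aux _ ?_, aux _ ?_, aux _ ?_, aux _ ?_⟩ <;>
    simp only [Set.mem_inter_iff, Set.mem_compl_iff] <;> tauto

end Halfspaces

section Combinatorics

/-- A crude multicolour Ramsey bound. -/
theorem exists_card_le_of_colored_cliques {α ι : Type*} [Fintype ι] (R : ι → α → α → Prop)
    (hsymm : ∀ i a b, R i a b → R i b a) (t : ℕ) :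
    ∃ N : ℕ, ∀ n : ι → ℕ, ∑ i, n i ≤ t → ∀ S : Finset α,
      (∀ a ∈ S, ∀ b ∈ S, a ≠ b → ∃ i, R i a b) →
      (∀ i, ∀ T ⊆ S, (∀ a ∈ T, ∀ b ∈ T, a ≠ b → R i a b) → T.card ≤ n i) →
      S.card ≤ N := by
  classical
  induction t with
  | zero =>
    refine ⟨1, fun n hn S hS hT => ?_⟩
    by_contra! hcard
    obtain ⟨a, ha, b, hb, hab⟩ := Finset.one_lt_card.1 hcard
    obtain ⟨i, -⟩ := hS a ha b hb hab
    have h1 := hT i {a} (by simpa using ha) (by simp)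
    have h2 := Finset.single_le_sum (f := n) (fun _ _ => Nat.zero_le _) (Finset.mem_univ i)
    simp only [Finset.card_singleton] at h1
    omega
  | succ t ih =>
    obtain ⟨N, hN⟩ := ih
    refine ⟨Fintype.card ι * N + 1, fun n hn S hS hT => ?_⟩
    obtain rfl | ⟨x, hx⟩ := S.eq_empty_or_nonempty
    · simp
    let nbr : ι → Finset α := fun i => S.filter (fun y => x ≠ y ∧ R i x y)
    have hsub : S ⊆ insert x (Finset.univ.biUnion nbr) := by
      intro y hy
      by_cases hxy : x = y
      · simp [hxy]
      · obtain ⟨i, hi⟩ := hS x hx y hy hxy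
        simp only [Finset.mem_insert, Finset.mem_biUnion, Finset.mem_univ, true_and, nbr,
          Finset.mem_filter]
        exact Or.inr ⟨i, hy, hxy, hi⟩
    have hnbr : ∀ i ∈ Finset.univ, (nbr i).card ≤ N := by
      intro i _
      have hni : 1 ≤ n i := by
        simpa using hT i {x} (by simpa using hx) (by simp)
      refine hN (Function.update n i (n i - 1)) ?_ _ ?_ ?_
      · have h1 := Finset.sum_update_of_mem (Finset.mem_univ i) n (n i - 1)
        have h2 := Finset.add_sum_erase Finset.univ n (Finset.mem_univ i)
        rw [Finset.erase_eq] at h2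
        omega
      · exact fun a ha b hb => hS a (Finset.filter_subset _ _ ha) b (Finset.filter_subset _ _ hb)
      · intro j T hTS hTR
        have hTS' : T ⊆ S := hTS.trans (Finset.filter_subset _ _)
        by_cases hj : j = i
        · subst hj
          have hxT : x ∉ T := fun h => (Finset.mem_filter.1 (hTS h)).2.1 rfl
          have h1 := hT j (insert x T) (Finset.insert_subset hx hTS') (by
            intro a ha b hb hab
            rcases Finset.mem_insert.1 ha with ha' | ha' <;>
              rcases Finset.mem_insert.1 hb with hb' | hb'
            · exact absurd (ha'.trans hb'.symm) hab
            · rw [ha']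
              exact (Finset.mem_filter.1 (hTS hb')).2.2
            · rw [hb']
              exact hsymm _ _ _ (Finset.mem_filter.1 (hTS ha')).2.2
            · exact hTR a ha' b hb' hab)
          rw [Finset.card_insert_of_notMem hxT] at h1
          rw [Function.update_self]
          omega
        · rw [Function.update_of_ne hj]
          exact hT j T hTS' hTR
    calc S.card ≤ _ := Finset.card_le_card hsub
      _ ≤ _ := Finset.card_insert_le _ _
      _ ≤ _ := by
        have := Finset.card_biUnion_le_card_mul Finset.univ nbr N hnbr
        simpa using this

/-- A finite chain can be enumerated decreasingly. -/
theorem exists_decreasing_enumeration {α β : Type*} [PartialOrder β] (f : α → β) (n : ℕ)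
    (T : Finset α) (hT : ∀ a ∈ T, ∀ b ∈ T, a ≠ b → f a < f b ∨ f b < f a) (hn : n ≤ T.card) :
    ∃ g : Fin n → α, (∀ i, g i ∈ T) ∧ ∀ i j, i < j → f (g j) < f (g i) := by
  classical
  induction n generalizing T with
  | zero => exact ⟨Fin.elim0, fun i => i.elim0, fun i => i.elim0⟩
  | succ n ih =>
    obtain ⟨a, haT, ha⟩ := T.exists_maximalFor f (Finset.card_pos.1 (by omega))
    obtain ⟨g, hgT, hg⟩ := ih (T.erase a)
      (fun b hb c hc => hT b (Finset.mem_of_mem_erase hb) c (Finset.mem_of_mem_erase hc))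
      (by rw [Finset.card_erase_of_mem haT]; omega)
    have hlt : ∀ i, f (g i) < f a := by
      intro i
      have hi := Finset.mem_erase.1 (hgT i)
      rcases hT _ hi.2 a haT hi.1 with h | h
      · exact h
      · exact absurd (ha hi.2 h.le) h.not_ge
    refine ⟨Fin.cons a g, fun i => ?_, fun i j hij => ?_⟩
    · refine Fin.cases ?_ (fun i => ?_) i
      · simpa using haT
      · simpa using Finset.mem_of_mem_erase (hgT i)
    · induction j using Fin.cases with
      | zero => exact absurd hij (Fin.not_lt_zero _)
      | succ j =>
        induction i using Fin.cases with
        | zero => simpa using hlt j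
        | succ i => simpa using hg i j (Fin.succ_lt_succ_iff.1 hij)

end Combinatorics

section Segments

variable {X : SimpleGraph V}

theorem Transv.symm {h k : Set V} (H : Transv h k) : Transv k h := by
  obtain ⟨h1, h2, h3, h4⟩ := H
  rw [Set.inter_comm] at h1 h2 h3 h4
  exact ⟨h1, h3, h2, h4⟩

theorem transv_or_subset_or_subset {h k : Set V} {x y : V} (hyh : y ∈ h) (hyk : y ∈ k)
    (hxh : x ∉ h) (hxk : x ∉ k) : Transv h k ∨ h ⊆ k ∨ k ⊆ h := by
  by_cases h1 : h ⊆ k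
  · exact Or.inr (Or.inl h1)
  by_cases h2 : k ⊆ h
  · exact Or.inr (Or.inr h2)
  obtain ⟨u, hu, hu'⟩ := Set.not_subset.1 h1
  obtain ⟨w, hw, hw'⟩ := Set.not_subset.1 h2
  exact Or.inl ⟨⟨y, hyh, hyk⟩, ⟨w, hw', hw⟩, ⟨u, hu, hu'⟩, ⟨x, hxh, hxk⟩⟩

theorem IsHSegment.antitone {l : ℕ} {t : Fin l → Set V} (ht : IsHSegment X l t) {i j : Fin l}
    (hij : i ≤ j) : t j ⊆ t i := by
  obtain ⟨i, hi⟩ := i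
  obtain ⟨j, hj⟩ := j
  simp only [Fin.mk_le_mk] at hij
  induction j, hij using Nat.le_induction with
  | base => exact subset_rfl
  | succ j _ ih =>
    exact (ht.2 ⟨j, by omega⟩ ⟨j + 1, hj⟩ rfl).1.1.trans (ih (by omega))

theorem IsHSegment.segIn_iff {l : ℕ} (hl : 0 < l) {t : Fin l → Set V} (ht : IsHSegment X l t)
    (x y : V) : SegIn X x y t ↔ y ∈ t ⟨l - 1, by omega⟩ ∧ x ∉ t ⟨0, hl⟩ := by
  constructor
  · exact fun h => ⟨(h _).2.1, (h _).2.2⟩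
  · rintro ⟨hy, hx⟩ i
    refine ⟨ht.1 i, ht.antitone (Fin.mk_le_mk.2 (by omega)) hy, fun hi => hx ?_⟩
    exact ht.antitone (i := ⟨0, hl⟩) (Fin.mk_le_mk.2 (Nat.zero_le _)) hi

theorem IsHSegment.exists_crossing {l : ℕ} (hl : 0 < l) {t : Fin l → Set V} {m : V}
    (h0 : m ∈ t ⟨0, hl⟩) (h1 : m ∉ t ⟨l - 1, by omega⟩) :
    ∃ i j : Fin l, (j : ℕ) = i + 1 ∧ m ∈ t i ∧ m ∉ t j := by
  by_contra! H
  have : ∀ n (hn : n < l), m ∈ t ⟨n, hn⟩ := by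
    intro n
    induction n with
    | zero => exact fun _ => h0
    | succ n ih => exact fun hn => H ⟨n, by omega⟩ ⟨n + 1, hn⟩ rfl (ih (by omega))
  exact h1 (this _ _)

/-- Comparable `H`-segments that agree in one place are equal. -/
theorem IsHSegment.eq_of_apply_eq {l : ℕ} {t t' : Fin l → Set V} (ht : IsHSegment X l t)
    (ht' : IsHSegment X l t') (hcomp : ∀ q, t q ⊆ t' q ∨ t' q ⊆ t q) (i : Fin l)
    (hi : t i = t' i) : t = t' := by
  have up : ∀ a b : Fin l, (b : ℕ) = a + 1 → t a = t' a → t b = t' b := by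
    intro a b hab hta
    by_contra hne
    have h1 := ht.2 a b hab
    have h2 := ht'.2 a b hab
    rcases hcomp b with h | h
    · exact h1.2 ⟨t' b, ht'.1 b, hta ▸ h2.1, h.ssubset_of_ne hne⟩
    · exact h2.2 ⟨t b, ht.1 b, hta ▸ h1.1, h.ssubset_of_ne (Ne.symm hne)⟩
  have down : ∀ a b : Fin l, (b : ℕ) = a + 1 → t b = t' b → t a = t' a := by
    intro a b hab htb
    by_contra hne
    have h1 := ht.2 a b hab
    have h2 := ht'.2 a b hab
    rcases hcomp a with h | h
    · exact h2.2 ⟨t a, ht.1 a, h.ssubset_of_ne hne, htb ▸ h1.1⟩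
    · exact h1.2 ⟨t' a, ht'.1 a, h.ssubset_of_ne (Ne.symm hne), htb ▸ h2.1⟩
  obtain ⟨i, hil⟩ := i
  have H0 : ∀ n (hn : n < l), n ≤ i → t ⟨i - n, by omega⟩ = t' ⟨i - n, by omega⟩ := by
    intro n
    induction n with
    | zero => exact fun _ _ => hi
    | succ n ih =>
      intro hn hni
      exact down ⟨i - (n + 1), by omega⟩ ⟨i - n, by omega⟩ (by simp only; omega)
        (ih (by omega) (by omega))
  have H : ∀ n (hn : n < l), t ⟨n, hn⟩ = t' ⟨n, hn⟩ := by
    intro n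
    induction n with
    | zero =>
      intro hn
      have := H0 i hil le_rfl
      simpa using this
    | succ n ih => exact fun hn => up ⟨n, by omega⟩ ⟨n + 1, hn⟩ rfl (ih (by omega))
  exact funext fun q => H q q.2

theorem IsHSegment.ssubset_succ {l : ℕ} {t t' : Fin l → Set V} (ht : IsHSegment X l t)
    (ht' : IsHSegment X l t') {i j : Fin l} (hij : (j : ℕ) = i + 1)
    (hcomp : t j ⊆ t' j ∨ t' j ⊆ t j) (hi : t i ⊂ t' i) : t j ⊂ t' j := by
  have key : ¬ t' j ⊆ t j := fun h =>
    (ht'.2 i j hij).2 ⟨t i, ht.1 i, hi, h.trans_ssubset (ht.2 i j hij).1⟩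
  exact ⟨hcomp.resolve_right key, key⟩

/-- In bounded dimension and with bounded staircases, the number of `H`-segments in `[x,y]_H`
having `m` between their `i`-th and `j = i + 1`-st entries is uniformly bounded. -/
theorem exists_card_crossing_at_le {D σ : ℕ} (hdim : DimLE X D) (hstair : StaircaseLE X σ)
    {l : ℕ} (i j : Fin l) (hij : (j : ℕ) = i + 1) :
    ∃ N : ℕ, ∀ (x y m : V) (S : Finset (Fin l → Set V)),
      (∀ t ∈ S, IsHSegment X l t ∧ SegIn X x y t ∧ m ∈ t i ∧ m ∉ t j) → S.card ≤ N := by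
  classical
  let R : Option (Fin l) → (Fin l → Set V) → (Fin l → Set V) → Prop := fun o t t' =>
    o.elim ((t i ⊂ t' i ∧ t j ⊂ t' j) ∨ (t' i ⊂ t i ∧ t' j ⊂ t j))
      (fun q => Transv (t q) (t' q))
  have hsymm : ∀ o a b, R o a b → R o b a := by
    rintro (_ | q) a b h
    · exact Or.symm h
    · exact Transv.symm h
  let n : Option (Fin l) → ℕ := fun o => o.elim σ (fun _ => D)
  obtain ⟨N, hN⟩ := exists_card_le_of_colored_cliques R hsymm (∑ o, n o)
  refine ⟨N, fun x y m S hS => hN n le_rfl S ?_ ?_⟩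
  · intro t ht t' ht' hne
    obtain ⟨hseg, hin, -, -⟩ := hS t ht
    obtain ⟨hseg', hin', -, -⟩ := hS t' ht'
    by_cases htr : ∃ q, Transv (t q) (t' q)
    · obtain ⟨q, hq⟩ := htr
      exact ⟨some q, hq⟩
    refine ⟨none, ?_⟩
    push Not at htr
    have hcomp : ∀ q, t q ⊆ t' q ∨ t' q ⊆ t q := fun q =>
      (transv_or_subset_or_subset (hin q).2.1 (hin' q).2.1 (hin q).2.2 (hin' q).2.2).resolve_left
        (htr q)
    have hnei : t i ≠ t' i := fun h => hne (hseg.eq_of_apply_eq hseg' hcomp i h)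
    rcases hcomp i with h | h
    · have h' := h.ssubset_of_ne hnei
      exact Or.inl ⟨h', hseg.ssubset_succ hseg' hij (hcomp j) h'⟩
    · have h' := h.ssubset_of_ne hnei.symm
      exact Or.inr ⟨h', hseg'.ssubset_succ hseg hij (hcomp j).symm h'⟩
  · rintro (_ | q) T hTS hT
    · by_contra! hcard
      obtain ⟨g, hgT, hg⟩ := exists_decreasing_enumeration (fun t : Fin l → Set V => t i)
        (σ + 1) T (fun a ha b hb hab => (hT a ha b hb hab).imp And.left And.left) hcard
      have hgS := fun a => hS _ (hTS (hgT a))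
      have hgj : ∀ a b, a < b → g b j ⊂ g a j := by
        intro a b hab
        have hab' := hg a b hab
        have hne : g b ≠ g a := fun h => hab'.ne (by rw [h])
        rcases hT _ (hgT b) _ (hgT a) hne with h | h
        · exact h.2
        · exact absurd hab' h.1.asymm
      refine hstair (fun a => g a i) (fun a => g a j) ⟨fun a => (hgS a).1.1 i,
        fun a => (hgS a).1.1 j, hg, hgj, fun a => ((hgS a).1.2 i j hij).1, fun a b hba => ?_⟩
      obtain ⟨-, hina, hma, -⟩ := hgS a
      obtain ⟨hsegb, hinb, -, hmb⟩ := hgS b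
      rcases transv_or_subset_or_subset (hina i).2.1 (hinb j).2.1 (hina i).2.2 (hinb j).2.2
        with h | h | h
      · exact h
      · exact absurd (h hma) hmb
      · exact absurd ⟨g a i, (hgS a).1.1 i, hg b a hba, h, fun h' => hmb (h' hma)⟩
          (hsegb.2 i j hij).2
    · have hinj : Set.InjOn (fun t : Fin l → Set V => t q) T := by
        intro a ha b hb hab
        by_contra hne
        have htr : Transv (a q) (b q) := hT a ha b hb hne
        simp only at hab
        rw [hab] at htr
        obtain ⟨v, hv, hv'⟩ := htr.2.1
        exact hv hv'
      rw [← Finset.card_image_of_injOn hinj]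
      refine hdim _ ?_ ?_
      · intro h hh
        obtain ⟨t, ht, rfl⟩ := Finset.mem_image.1 hh
        exact (hS t (hTS ht)).1.1 q
      · intro h hh k hk hne
        obtain ⟨t, ht, rfl⟩ := Finset.mem_image.1 hh
        obtain ⟨t', ht', rfl⟩ := Finset.mem_image.1 hk
        exact hT t ht t' ht' (fun h => hne (by rw [h]))

theorem exists_card_crossing_le {D σ : ℕ} (hdim : DimLE X D) (hstair : StaircaseLE X σ)
    {l : ℕ} (hl : 0 < l) :
    ∃ N : ℕ, ∀ (x y m : V) (S : Finset (Fin l → Set V)),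
      (∀ t ∈ S, IsHSegment X l t ∧ SegIn X x y t ∧ m ∈ t ⟨0, hl⟩ ∧ m ∉ t ⟨l - 1, by omega⟩) →
      S.card ≤ N := by
  classical
  have h : ∀ p : Fin l × Fin l, ∃ N : ℕ, (p.2 : ℕ) = p.1 + 1 →
      ∀ (x y m : V) (S : Finset (Fin l → Set V)),
      (∀ t ∈ S, IsHSegment X l t ∧ SegIn X x y t ∧ m ∈ t p.1 ∧ m ∉ t p.2) → S.card ≤ N := by
    intro p
    by_cases hp : (p.2 : ℕ) = p.1 + 1
    · obtain ⟨N, hN⟩ := exists_card_crossing_at_le hdim hstair p.1 p.2 hp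
      exact ⟨N, fun _ => hN⟩
    · exact ⟨0, fun h => absurd h hp⟩
  choose N hN using h
  refine ⟨∑ p, N p, fun x y m S hS => ?_⟩
  let A : Fin l × Fin l → Finset (Fin l → Set V) := fun p =>
    S.filter (fun t => (p.2 : ℕ) = p.1 + 1 ∧ m ∈ t p.1 ∧ m ∉ t p.2)
  have hsub : S ⊆ Finset.univ.biUnion A := by
    intro t ht
    obtain ⟨-, -, h0, h1⟩ := hS t ht
    obtain ⟨i, j, hij, hi, hj⟩ := IsHSegment.exists_crossing hl h0 h1
    simp only [Finset.mem_biUnion, Finset.mem_univ, true_and, A, Finset.mem_filter]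
    exact ⟨(i, j), ht, hij, hi, hj⟩
  refine (Finset.card_le_card hsub).trans (Finset.card_biUnion_le.trans
    (Finset.sum_le_sum fun p _ => ?_))
  by_cases hp : (p.2 : ℕ) = p.1 + 1
  · refine hN p hp x y m _ fun t ht => ?_
    obtain ⟨htS, -, h1, h2⟩ := Finset.mem_filter.1 ht
    exact ⟨(hS t htS).1, (hS t htS).2.1, h1, h2⟩
  · have : A p = ∅ := Finset.filter_eq_empty_iff.2 fun t _ h => hp h.1
    simp [this]

end Segments

section Action

variable {X : SimpleGraph V} {Γ : Type*} [Group Γ] [MulAction Γ V]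

theorem smul_mem_image_smul {γ : Γ} {h : Set V} {v : V} : γ • v ∈ (γ • ·) '' h ↔ v ∈ h :=
  (MulAction.injective γ).mem_set_image

theorem ActsOn.dist_smul (hact : ActsOn Γ X) (hc : X.Connected) (γ : Γ) (a b : V) :
    X.dist (γ • a) (γ • b) = X.dist a b := by
  have key : ∀ (γ : Γ) (a b : V), X.dist (γ • a) (γ • b) ≤ X.dist a b := by
    intro γ a b
    obtain ⟨p, hp⟩ := hc.exists_walk_length_eq_dist a b
    have h := SimpleGraph.dist_le
      (p.map (⟨(γ • ·), fun {u v} huv => hact γ u v huv⟩ : X →g X))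
    rw [SimpleGraph.Walk.length_map, hp] at h
    exact h
  refine le_antisymm (key γ a b) ?_
  simpa using key γ⁻¹ (γ • a) (γ • b)

theorem ActsOn.image_setOf_dist_lt (hact : ActsOn Γ X) (hc : X.Connected) (γ : Γ) (a b : V) :
    (γ • ·) '' {v | X.dist v a < X.dist v b} =
      {v | X.dist v (γ • a) < X.dist v (γ • b)} := by
  ext v
  obtain ⟨w, rfl⟩ := MulAction.surjective γ v
  rw [smul_mem_image_smul]
  simp [hact.dist_smul hc]

theorem ActsOn.isHalfspace_image (hact : ActsOn Γ X) (hc : X.Connected) (γ : Γ) {h : Set V}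
    (hh : IsHalfspace X h) : IsHalfspace X ((γ • ·) '' h) := by
  obtain ⟨a, b, hab, rfl⟩ := hh
  exact ⟨γ • a, γ • b, hact γ a b hab, hact.image_setOf_dist_lt hc γ a b⟩

theorem ActsOn.edgeDual_image (hact : ActsOn Γ X) (hc : X.Connected) (γ : Γ) {h : Set V}
    {a b : V} (hab : EdgeDual X h a b) : EdgeDual X ((γ • ·) '' h) (γ • a) (γ • b) := by
  refine ⟨hact γ a b hab.1, ?_⟩
  rw [← hact.image_setOf_dist_lt hc, ← hact.image_setOf_dist_lt hc]
  exact hab.2.imp (fun h => by rw [h]) (fun h => by rw [h])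

theorem image_smul_image_smul (γ γ' : Γ) (h : Set V) :
    (γ • ·) '' ((γ' • ·) '' h) = ((γ * γ') • ·) '' h := by
  rw [Set.image_image]
  simp only [mul_smul]

theorem segSMul_mul {l : ℕ} (γ γ' : Γ) (s : Fin l → Set V) :
    segSMul γ (segSMul γ' s) = segSMul (γ * γ') s :=
  funext fun i => image_smul_image_smul γ γ' (s i)

theorem segSMul_one {l : ℕ} (s : Fin l → Set V) : segSMul (1 : Γ) s = s := by
  funext i
  simp [segSMul]

theorem segSMul_injective {l : ℕ} (γ : Γ) :
    Function.Injective (segSMul γ : (Fin l → Set V) → (Fin l → Set V)) := by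
  intro s t hst
  have h := congrArg (segSMul γ⁻¹) hst
  simpa only [segSMul_mul, inv_mul_cancel, segSMul_one] using h

theorem ActsOn.isHSegment_segSMul (hact : ActsOn Γ X) (hc : X.Connected) (γ : Γ) {l : ℕ}
    {s : Fin l → Set V} (hs : IsHSegment X l s) : IsHSegment X l (segSMul γ s) := by
  refine ⟨fun i => hact.isHalfspace_image hc γ (hs.1 i), fun i j hij => ?_⟩
  have himg : ∀ {h k : Set V}, (γ • ·) '' h ⊂ (γ • ·) '' k ↔ h ⊂ k :=
    (MulAction.injective γ).injOn.image_ssubset_image_iff (Set.subset_univ _) (Set.subset_univ _)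
  obtain ⟨h1, h2⟩ := hs.2 i j hij
  refine ⟨himg.2 h1, ?_⟩
  rintro ⟨k, hk, hk1, hk2⟩
  have hkk : (γ • ·) '' ((γ⁻¹ • ·) '' k) = k := by
    rw [image_smul_image_smul]
    simp
  rw [← hkk] at hk1 hk2
  exact h2 ⟨_, hact.isHalfspace_image hc γ⁻¹ hk, himg.1 hk1,
    himg.1 hk2⟩

theorem ActsOn.segIn_segSMul (hact : ActsOn Γ X) (hc : X.Connected) (γ : Γ) {l : ℕ}
    {s : Fin l → Set V} {x y : V} (hs : SegIn X x y s) :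
    SegIn X (γ • x) (γ • y) (segSMul γ s) := fun i =>
  ⟨hact.isHalfspace_image hc γ (hs i).1, smul_mem_image_smul.2 (hs i).2.1,
    fun h => (hs i).2.2 (smul_mem_image_smul.1 h)⟩

theorem ActsOn.translatesIn_smul (hact : ActsOn Γ X) (hc : X.Connected) (γ : Γ) {l : ℕ}
    (s : Fin l → Set V) (x y : V) :
    translatesIn X Γ s (γ • x) (γ • y) = segSMul γ '' translatesIn X Γ s x y := by
  ext t
  constructor
  · rintro ⟨⟨γ', rfl⟩, hin⟩
    refine ⟨segSMul (γ⁻¹ * γ') s, ⟨⟨_, rfl⟩, ?_⟩, ?_⟩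
    · simpa [segSMul_mul] using hact.segIn_segSMul hc γ⁻¹ hin
    · simp [segSMul_mul]
  · rintro ⟨_, ⟨⟨γ', rfl⟩, hin⟩, rfl⟩
    exact ⟨⟨γ * γ', segSMul_mul _ _ _⟩, hact.segIn_segSMul hc γ hin⟩

theorem ActsOn.isHead_segSMul (hact : ActsOn Γ X) (hc : X.Connected) (γ : Γ) {l : ℕ}
    (hl : 0 < l) {s : Fin l → Set V} {a : V} (ha : IsHead X hl s a) :
    IsHead X hl (segSMul γ s) (γ • a) := by
  obtain ⟨h, b, hb⟩ := ha
  exact ⟨fun h' => h (smul_mem_image_smul.1 h'), γ • b, hact.edgeDual_image hc γ hb⟩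

theorem IsHSegment.exists_isHead {l : ℕ} (hl : 0 < l) {s : Fin l → Set V}
    (hs : IsHSegment X l s) : ∃ a, IsHead X hl s a := by
  obtain ⟨a, b, hab, h⟩ := hs.1 ⟨0, hl⟩
  have hd : EdgeDual X (s ⟨0, hl⟩) b a := ⟨hab.symm, Or.inr h⟩
  refine ⟨b, ?_, a, hd⟩
  rw [hd.mem_iff_notMem, not_not, h]
  simp [SimpleGraph.dist_eq_one_iff_adj.2 hab]

theorem translatesIn_finite (hmed : IsMedianGraph X) {l : ℕ} (s : Fin l → Set V) (x y : V) :
    (translatesIn X Γ s x y).Finite :=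
  (Set.Finite.pi' fun _ : Fin l => sepH_finite hmed x y).subset fun _ ht => ht.2

end Action

section SignedSums

variable {X : SimpleGraph V} {Γ : Type*} [Group Γ] [MulAction Γ V] {l : ℕ}

variable (X Γ) in
/-- The weighted count of the translates of `s` separating `y` from `x`, those in `[x,y]_H`
counted positively and those in `[y,x]_H` negatively. -/
noncomputable def signedSum (s : Fin l → Set V) (φ : (Fin l → Set V) → ℝ) (x y : V) : ℝ :=
  ∑ᶠ t ∈ translatesIn X Γ s x y, φ t - ∑ᶠ t ∈ translatesIn X Γ s y x, φ t

theorem signedSum_one (hmed : IsMedianGraph X) (s : Fin l → Set V) (x y : V) :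
    signedSum X Γ s (fun _ => 1) x y = fs X Γ s x y := by
  unfold signedSum fs
  have h : ∀ x y, ∑ᶠ t ∈ translatesIn X Γ s x y, (1 : ℝ) = (translatesIn X Γ s x y).ncard := by
    intro x y
    rw [finsum_mem_eq_finite_toFinset_sum _ (translatesIn_finite hmed s x y),
      Set.ncard_eq_toFinset_card _ (translatesIn_finite hmed s x y)]
    simp
  rw [h, h]

theorem signedSum_congr {s : Fin l → Set V} {φ ψ : (Fin l → Set V) → ℝ}
    (h : ∀ γ : Γ, φ (segSMul γ s) = ψ (segSMul γ s)) (x y : V) :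
    signedSum X Γ s φ x y = signedSum X Γ s ψ x y := by
  have h' : ∀ x y, ∑ᶠ t ∈ translatesIn X Γ s x y, φ t = ∑ᶠ t ∈ translatesIn X Γ s x y, ψ t := by
    intro x y
    refine finsum_mem_congr rfl ?_
    rintro _ ⟨⟨γ, rfl⟩, -⟩
    exact h γ
  unfold signedSum
  rw [h', h']

theorem signedSum_add (hmed : IsMedianGraph X) (s : Fin l → Set V)
    (φ ψ : (Fin l → Set V) → ℝ) (x y : V) :
    signedSum X Γ s (fun t => φ t + ψ t) x y = signedSum X Γ s φ x y + signedSum X Γ s ψ x y := by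
  unfold signedSum
  rw [finsum_mem_add_distrib (translatesIn_finite hmed s x y),
    finsum_mem_add_distrib (translatesIn_finite hmed s y x)]
  ring

theorem signedSum_mul_right (s : Fin l → Set V) (φ : (Fin l → Set V) → ℝ) (c : ℝ) (x y : V) :
    signedSum X Γ s (fun t => φ t * c) x y = signedSum X Γ s φ x y * c := by
  unfold signedSum
  rw [← finsum_mem_mul, ← finsum_mem_mul]
  ring

theorem signedSum_smul (hact : ActsOn Γ X) (hc : X.Connected) (γ : Γ) (s : Fin l → Set V)
    (φ : (Fin l → Set V) → ℝ) (x y : V) :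
    signedSum X Γ s φ (γ • x) (γ • y) = signedSum X Γ s (fun t => φ (segSMul γ t)) x y := by
  unfold signedSum
  rw [hact.translatesIn_smul hc, hact.translatesIn_smul hc,
    finsum_mem_image (segSMul_injective γ).injOn, finsum_mem_image (segSMul_injective γ).injOn]

theorem exists_abs_sum_translates_le {D σ : ℕ} (hmed : IsMedianGraph X) (hdim : DimLE X D)
    (hstair : StaircaseLE X σ) (hact : ActsOn Γ X) (hl : 0 < l) {s : Fin l → Set V}
    (hs : IsHSegment X l s) :
    ∃ N : ℕ, ∀ (φ : (Fin l → Set V) → ℝ) (C : ℝ), (∀ t, |φ t| ≤ C) →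
      ∀ x y m, m ∈ interval X x y →
      |∑ᶠ t ∈ translatesIn X Γ s x y, φ t - ∑ᶠ t ∈ translatesIn X Γ s x m, φ t -
        ∑ᶠ t ∈ translatesIn X Γ s m y, φ t| ≤ N * C := by
  obtain ⟨N, hN⟩ := exists_card_crossing_le hdim hstair hl
  refine ⟨N, fun φ C hφ x y m hm => ?_⟩
  have hseg : ∀ γ : Γ, IsHSegment X l (segSMul γ s) := fun γ =>
    hact.isHSegment_segSMul hmed.1 γ hs
  let K : Set (Fin l → Set V) :=
    {t | t ∈ translatesIn X Γ s x y ∧ m ∈ t ⟨0, hl⟩ ∧ m ∉ t ⟨l - 1, by omega⟩}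
  have hK : K.Finite := (translatesIn_finite (Γ := Γ) hmed s x y).subset fun _ h => h.1
  have hunion : translatesIn X Γ s x y =
      (translatesIn X Γ s x m ∪ translatesIn X Γ s m y) ∪ K := by
    ext t
    constructor
    · rintro ⟨⟨γ, rfl⟩, hin⟩
      have hin' := ((hseg γ).segIn_iff hl x y).1 hin
      by_cases h1 : m ∈ segSMul γ s ⟨l - 1, by omega⟩
      · exact Or.inl (Or.inl ⟨⟨γ, rfl⟩, ((hseg γ).segIn_iff hl x m).2 ⟨h1, hin'.2⟩⟩)
      by_cases h0 : m ∈ segSMul γ s ⟨0, hl⟩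
      · exact Or.inr ⟨⟨⟨γ, rfl⟩, hin⟩, h0, h1⟩
      · exact Or.inl (Or.inr ⟨⟨γ, rfl⟩, ((hseg γ).segIn_iff hl m y).2 ⟨hin'.1, h0⟩⟩)
    · rintro ((⟨hγ, hin⟩ | ⟨hγ, hin⟩) | h)
      · refine ⟨hγ, fun i => ⟨(hin i).1, ?_, (hin i).2.2⟩⟩
        by_contra hy
        exact ((hin i).1.compl hmed).mem_of_mem_interval hmed (hin i).2.2 hy hm (hin i).2.1
      · refine ⟨hγ, fun i => ⟨(hin i).1, (hin i).2.1, fun hx => ?_⟩⟩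
        exact (hin i).2.2 ((hin i).1.mem_of_mem_interval hmed hx (hin i).2.1 hm)
      · exact h.1
  have hd1 : Disjoint (translatesIn X Γ s x m) (translatesIn X Γ s m y) :=
    Set.disjoint_left.2 fun t h h' => (h'.2 ⟨0, hl⟩).2.2 (h.2 ⟨0, hl⟩).2.1
  have hd2 : Disjoint (translatesIn X Γ s x m ∪ translatesIn X Γ s m y) K := by
    refine Set.disjoint_left.2 ?_
    rintro t (h | h) hk
    · exact hk.2.2 (h.2 _).2.1
    · exact (h.2 _).2.2 hk.2.1
  have f1 := translatesIn_finite (Γ := Γ) hmed s x m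
  have f2 := translatesIn_finite (Γ := Γ) hmed s m y
  rw [hunion, finsum_mem_union hd2 (f1.union f2) hK, finsum_mem_union hd1 f1 f2]
  have hC : 0 ≤ C := (abs_nonneg _).trans (hφ s)
  have hcard : hK.toFinset.card ≤ N := by
    refine hN x y m _ fun t ht => ?_
    obtain ⟨⟨⟨γ, rfl⟩, hin⟩, h0, h1⟩ := hK.mem_toFinset.1 ht
    exact ⟨hseg γ, hin, h0, h1⟩
  calc _ = |∑ᶠ t ∈ K, φ t| := by congr 1; ring
    _ = |∑ t ∈ hK.toFinset, φ t| := by rw [finsum_mem_eq_finite_toFinset_sum _ hK]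
    _ ≤ ∑ t ∈ hK.toFinset, |φ t| := Finset.abs_sum_le_sum_abs _ _
    _ ≤ hK.toFinset.card • C := Finset.sum_le_card_nsmul _ _ _ fun t _ => hφ t
    _ ≤ N * C := by
      rw [nsmul_eq_mul]
      exact mul_le_mul_of_nonneg_right (by exact_mod_cast hcard) hC

theorem interval_comm (x y : V) : interval X x y = interval X y x := by
  ext m
  simp only [interval, Set.mem_ofPred_eq]
  rw [SimpleGraph.dist_comm (u := x) (v := m), SimpleGraph.dist_comm (u := m) (v := y),
    SimpleGraph.dist_comm (u := x) (v := y), add_comm]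

/-- Bounded weights give a quasimorphism, with defect linear in the bound. -/
theorem exists_abs_d1_signedSum_le {D σ : ℕ} (hmed : IsMedianGraph X) (hdim : DimLE X D)
    (hstair : StaircaseLE X σ) (hact : ActsOn Γ X) (hl : 0 < l) {s : Fin l → Set V}
    (hs : IsHSegment X l s) :
    ∃ N : ℝ, ∀ (φ : (Fin l → Set V) → ℝ) (C : ℝ), (∀ t, |φ t| ≤ C) →
      ∀ x y z, |d1 (signedSum X Γ s φ) x y z| ≤ N * C := by
  obtain ⟨N, hN⟩ := exists_abs_sum_translates_le hmed hdim hstair hact hl hs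
  refine ⟨6 * N, fun φ C hφ x y z => ?_⟩
  obtain ⟨m, ⟨hxy, hyz, hxz⟩, -⟩ := hmed.2 x y z
  have e1 := abs_le.1 (hN φ C hφ x y m hxy)
  have e2 := abs_le.1 (hN φ C hφ y z m hyz)
  have e3 := abs_le.1 (hN φ C hφ x z m hxz)
  rw [interval_comm] at hxy hyz hxz
  have e4 := abs_le.1 (hN φ C hφ y x m hxy)
  have e5 := abs_le.1 (hN φ C hφ z y m hyz)
  have e6 := abs_le.1 (hN φ C hφ z x m hxz)
  simp only [d1, signedSum]
  rw [abs_le]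
  constructor <;> linarith

end SignedSums

section Cocycles

variable {X : SimpleGraph V} {Γ : Type*} [Group Γ] [MulAction Γ V]

theorem fs_eq_of_mem_iff_mem {p : ℕ} (hp : 0 < p) {r : Fin p → Set V}
    (hr : ∀ γ : Γ, IsHSegment X p (segSMul γ r)) {a a' : V}
    (h0 : ∀ γ : Γ, a ∈ segSMul γ r ⟨0, hp⟩ ↔ a' ∈ segSMul γ r ⟨0, hp⟩)
    (h1 : ∀ γ : Γ, a ∈ segSMul γ r ⟨p - 1, by omega⟩ ↔ a' ∈ segSMul γ r ⟨p - 1, by omega⟩)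
    (x : V) : fs X Γ r a x = fs X Γ r a' x := by
  have e1 : translatesIn X Γ r a x = translatesIn X Γ r a' x := by
    ext t
    refine and_congr_right ?_
    rintro ⟨γ, rfl⟩
    rw [(hr γ).segIn_iff hp, (hr γ).segIn_iff hp, h0]
  have e2 : translatesIn X Γ r x a = translatesIn X Γ r x a' := by
    ext t
    refine and_congr_right ?_
    rintro ⟨γ, rfl⟩
    rw [(hr γ).segIn_iff hp, (hr γ).segIn_iff hp, h1]
  rw [fs, fs, e1, e2]

theorem fs_eq_of_edgeDual (hmed : IsMedianGraph X) {p : ℕ} (hp : 0 < p) {r : Fin p → Set V}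
    (hr : ∀ γ : Γ, IsHSegment X p (segSMul γ r)) {h : Set V}
    (hnt : ∀ γ : Γ, ¬ Transv h (segSMul γ r ⟨0, hp⟩) ∧
      ¬ Transv h (segSMul γ r ⟨p - 1, by omega⟩))
    {a b a' b' : V} (hab : EdgeDual X h a b) (hab' : EdgeDual X h a' b')
    (haa' : a ∈ h ↔ a' ∈ h) (x : V) : fs X Γ r a x = fs X Γ r a' x :=
  fs_eq_of_mem_iff_mem hp hr
    (fun γ => mem_iff_mem_of_not_transv hmed hab hab' haa' ((hr γ).1 _) (hnt γ).1)
    (fun γ => mem_iff_mem_of_not_transv hmed hab hab' haa' ((hr γ).1 _) (hnt γ).2) x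

theorem fs_smul (hmed : IsMedianGraph X) (hact : ActsOn Γ X) {l : ℕ} (s : Fin l → Set V)
    (γ : Γ) (x y : V) : fs X Γ s (γ • x) (γ • y) = fs X Γ s x y := by
  rw [← signedSum_one hmed, ← signedSum_one hmed, signedSum_smul hact hmed.1]

theorem nonTransverseTo_d1_fs (hmed : IsMedianGraph X) {l p : ℕ} (hl : 0 < l) (hp : 0 < p)
    {r : Fin p → Set V} (hr : ∀ γ : Γ, IsHSegment X p (segSMul γ r)) {t : Fin l → Set V}
    (hnt : ∀ a, (a = t ⟨0, hl⟩ ∨ a = t ⟨l - 1, by omega⟩) → ∀ γ : Γ,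
      ¬ Transv a (segSMul γ r ⟨0, hp⟩) ∧ ¬ Transv a (segSMul γ r ⟨p - 1, by omega⟩)) :
    NonTransverseTo X hl (fun v : Fin 3 → V => d1 (fs X Γ r) (v 0) (v 1) (v 2)) t := by
  refine ⟨fun x a a' ha ha' => ?_, fun x a a' ha ha' => ?_⟩
  · obtain ⟨ha, b, hb⟩ := ha
    obtain ⟨ha', b', hb'⟩ := ha'
    have h := fs_eq_of_edgeDual hmed hp hr (hnt _ (Or.inl rfl)) hb hb' (iff_of_false ha ha')
    change d1 (fs X Γ r) a (x 0) (x 1) = d1 (fs X Γ r) a' (x 0) (x 1)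
    simp only [d1, h]
  · obtain ⟨ha, b, hb⟩ := ha
    obtain ⟨ha', b', hb'⟩ := ha'
    have h := fs_eq_of_edgeDual hmed hp hr (hnt _ (Or.inr rfl)) hb hb' (iff_of_true ha ha')
    change d1 (fs X Γ r) a (x 0) (x 1) = d1 (fs X Γ r) a' (x 0) (x 1)
    simp only [d1, h]

open Classical in
/-- The value of a function at a chosen head of the segment `t`. -/
noncomputable def headValue (X : SimpleGraph V) {l : ℕ} (hl : 0 < l) (κ : V → ℝ)
    (t : Fin l → Set V) : ℝ :=
  if h : ∃ a, IsHead X hl t a then κ h.choose else 0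

theorem abs_headValue_le {l : ℕ} (hl : 0 < l) {κ : V → ℝ} {C : ℝ} (hC : 0 ≤ C)
    (hκ : ∀ a, |κ a| ≤ C) (t : Fin l → Set V) : |headValue X hl κ t| ≤ C := by
  unfold headValue
  split_ifs
  · exact hκ _
  · simpa using hC

theorem headValue_eq {l : ℕ} (hl : 0 < l) {κ : V → ℝ} {t : Fin l → Set V}
    (hκ : ∀ a a', IsHead X hl t a → IsHead X hl t a' → κ a = κ a') {a : V}
    (ha : IsHead X hl t a) : headValue X hl κ t = κ a := by
  have h : ∃ a, IsHead X hl t a := ⟨a, ha⟩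
  unfold headValue
  rw [dif_pos h]
  exact hκ _ _ h.choose_spec ha

/-- If `f` is an invariant function with bounded coboundary whose coboundary is non-transverse
to the heads of the translates of `s`, then the cup product of the coboundaries of `f_s` and `f`
has a bounded invariant primitive. -/
theorem exists_bounded_primitive {D σ : ℕ} (hmed : IsMedianGraph X) (hdim : DimLE X D)
    (hstair : StaircaseLE X σ) (hact : ActsOn Γ X) {l : ℕ} (hl : 0 < l) {s : Fin l → Set V}
    (hs : IsHSegment X l s) {f : V → V → ℝ} (hf : ∀ (γ : Γ) x y, f (γ • x) (γ • y) = f x y)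
    {C : ℝ} (hC : ∀ x y z, |d1 f x y z| ≤ C)
    (hheads : ∀ (γ : Γ) (a a' : V), IsHead X hl (segSMul γ s) a → IsHead X hl (segSMul γ s) a' →
      ∀ y z, d1 f a y z = d1 f a' y z) :
    ∃ β : (Fin 4 → V) → ℝ, IsBounded β ∧ IsInvariant Γ β ∧
      ∀ x : Fin 5 → V,
        cob β x = d1 (fs X Γ s) (x 0) (x 1) (x 2) * d1 f (x 2) (x 3) (x 4) := by
  let c : V → V → (Fin l → Set V) → ℝ := fun y z => headValue X hl (fun a => d1 f a y z)
  let η : V → V → V → ℝ := fun x y z => signedSum X Γ s (c y z) x y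
  have hseg : ∀ γ : Γ, IsHSegment X l (segSMul γ s) := fun γ =>
    hact.isHSegment_segSMul hmed.1 γ hs
  have hc : ∀ (γ : Γ) a, IsHead X hl (segSMul γ s) a → ∀ y z,
      c y z (segSMul γ s) = d1 f a y z := fun γ a ha y z =>
    headValue_eq hl (fun a a' h h' => hheads γ a a' h h' y z) ha
  have hη : ∀ (γ : Γ) x y z, η (γ • x) (γ • y) (γ • z) = η x y z := by
    intro γ x y z
    simp only [η]
    rw [signedSum_smul hact hmed.1]
    refine signedSum_congr (fun γ' => ?_) x y
    obtain ⟨a, ha⟩ := (hseg γ').exists_isHead hl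
    have ha' := hact.isHead_segSMul hmed.1 γ hl ha
    rw [segSMul_mul] at ha'
    rw [segSMul_mul, hc _ _ ha', hc _ _ ha]
    simp only [d1, hf]
  refine ⟨fun x => fs X Γ s (x 0) (x 1) * d1 f (x 1) (x 2) (x 3) +
    (η (x 1) (x 2) (x 3) - η (x 0) (x 2) (x 3) + η (x 0) (x 1) (x 3) - η (x 0) (x 1) (x 2)),
    ?_, ?_, ?_⟩
  · obtain ⟨N, hN⟩ := exists_abs_d1_signedSum_le (Γ := Γ) hmed hdim hstair hact hl hs
    refine ⟨N * C, fun x => ?_⟩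
    have hcC : ∀ t, |c (x 2) (x 3) t| ≤ C := abs_headValue_le hl
      ((abs_nonneg _).trans (hC (x 0) (x 0) (x 0))) (fun a => hC a (x 2) (x 3))
    have key : signedSum X Γ s (c (x 2) (x 3)) (x 0) (x 1) + η (x 0) (x 1) (x 2) =
        fs X Γ s (x 0) (x 1) * d1 f (x 1) (x 2) (x 3) + η (x 0) (x 1) (x 3) := by
      simp only [η]
      rw [← signedSum_one hmed, ← signedSum_mul_right, ← signedSum_add hmed,
        ← signedSum_add hmed]
      refine signedSum_congr (fun γ => ?_) _ _
      obtain ⟨a, ha⟩ := (hseg γ).exists_isHead hl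
      rw [hc _ _ ha, hc _ _ ha, hc _ _ ha]
      simp only [d1]
      ring
    have hbd := hN _ C hcC (x 0) (x 1) (x 2)
    convert hbd using 2
    simp only [d1, η] at key ⊢
    linarith
  · intro γ x
    simp only [hη, d1, hf, fs_smul hmed hact]
  · intro x
    simp only [cob, Fin.sum_univ_succ, Fin.sum_univ_zero, d1]
    simp [Fin.succAbove, Fin.lt_def]
    ring

end Cocycles

/-- Theorem `thm:cuptwomedian`: on a median graph of dimension at
most `D` and staircase length at most `σ`, if `s`, `r` are H-segments such that all
translates of the first/last halfspaces of `s` are non-transverse to all translates of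
the first/last halfspaces of `r`, then `δ¹f_r` is non-transverse to the orbit `Γs`,
and `(δ¹f_s) ∪ (δ¹f_r)` has a bounded Γ-invariant primitive; i.e.
`[δ¹f_s] ∪ [δ¹f_r] = 0` in degree-4 equivariant bounded cohomology. -/
theorem statement4 {V : Type*} (X : SimpleGraph V) (D σ : ℕ)
    (hmed : IsMedianGraph X) (hdim : DimLE X D) (hstair : StaircaseLE X σ)
    (Γ : Type*) [Group Γ] [MulAction Γ V] (hact : ActsOn Γ X)
    (l p : ℕ) (hl : 1 ≤ l) (hp : 1 ≤ p)
    (s : Fin l → Set V) (hseg : IsHSegment X l s)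
    (r : Fin p → Set V) (hrseg : IsHSegment X p r)
    (hnt : ∀ a b : Set V,
      (a = s ⟨0, hl⟩ ∨ a = s ⟨l - 1, by omega⟩) →
      (b = r ⟨0, hp⟩ ∨ b = r ⟨p - 1, by omega⟩) →
      ∀ γ γ' : Γ, ¬ Transv ((γ • ·) '' a) ((γ' • ·) '' b)) :
    (∀ γ : Γ, NonTransverseTo X hl
        (fun v : Fin 3 → V => d1 (fs X Γ r) (v 0) (v 1) (v 2)) (segSMul γ s)) ∧
    ∃ β : (Fin 4 → V) → ℝ, IsBounded β ∧ IsInvariant Γ β ∧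
      ∀ x : Fin 5 → V,
        cob β x =
          d1 (fs X Γ s) (x 0) (x 1) (x 2) * d1 (fs X Γ r) (x 2) (x 3) (x 4) := by
  have hnt' : ∀ γ : Γ, ∀ a,
      (a = segSMul γ s ⟨0, hl⟩ ∨ a = segSMul γ s ⟨l - 1, by omega⟩) → ∀ γ' : Γ,
      ¬ Transv a (segSMul γ' r ⟨0, hp⟩) ∧ ¬ Transv a (segSMul γ' r ⟨p - 1, by omega⟩) := by
    rintro γ _ (rfl | rfl) γ'
    · exact ⟨hnt _ _ (Or.inl rfl) (Or.inl rfl) γ γ', hnt _ _ (Or.inl rfl) (Or.inr rfl) γ γ'⟩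
    · exact ⟨hnt _ _ (Or.inr rfl) (Or.inl rfl) γ γ', hnt _ _ (Or.inr rfl) (Or.inr rfl) γ γ'⟩
  have hr : ∀ γ : Γ, IsHSegment X p (segSMul γ r) := fun γ =>
    hact.isHSegment_segSMul hmed.1 γ hrseg
  have hκ := fun γ : Γ => nonTransverseTo_d1_fs (Γ := Γ) hmed hl hp hr (hnt' γ)
  refine ⟨hκ, ?_⟩
  obtain ⟨N, hN⟩ := exists_abs_d1_signedSum_le (Γ := Γ) hmed hdim hstair hact hp hrseg
  refine exists_bounded_primitive hmed hdim hstair hact hl hseg (C := N * 1)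
    (fun γ x y => fs_smul hmed hact r γ x y) (fun x y z => ?_) ?_
  · simpa only [d1, signedSum_one hmed] using hN (fun _ => 1) 1 (by simp) x y z
  · intro γ a a' ha ha' y z
    exact (hκ γ).1 ![y, z] a a' ha ha'

end MedianQM
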